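/- Let V be a finite type, T : ℕ, ℓ a layered relation on V × Fin (T+1) (ℓ (v, s) (w, s') implies (s' : ℕ) = (s : ℕ) + 1), and t : Fin (T+1). Let D be a finset of V × Fin (T+1) such that (i) every (u, s) ∈ D satisfies (s : ℕ) ≤ (t : ℕ), and (ii) D is forward-closed below layer t: for every (u, s) ∈ D with (s : ℕ) < (t : ℕ) and every w with ℓ (u, s) (w, s'), the node (w, s') belongs to D. Let f(A) = |ρ(A)| be the spread, and let D_t = {(u, s) ∈ D : s = t} be the layer-t part of D. Then for every v : V, the marginal gain of seeding (v, t) depends only on the current layer: f(D ∪ {(v, t)}) − f(D) = f(D_t ∪ {(v, t)}) − f(D_t), the differences being taken in ℤ. -/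

import Mathlib

/-- The set of layered-graph nodes reachable from the finset `A`. -/
def reachSet {N : Type*} (ℓ : N → N → Prop) (A : Finset N) : Set N :=
  {x : N | ∃ y ∈ A, Relation.ReflTransGen ℓ y x}

/-- The spread of a seed finset `A`: the cardinality of its reachable set. -/
noncomputable def spread {N : Type*} (ℓ : N → N → Prop) (A : Finset N) : ℕ :=
  (reachSet ℓ A).ncard

theorem reachSet_mono {N : Type*} (ℓ : N → N → Prop) {A B : Finset N} (h : A ⊆ B) :
    reachSet ℓ A ⊆ reachSet ℓ B := by
  rintro x ⟨y, hy, hyx⟩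
  exact ⟨y, h hy, hyx⟩

theorem reachSet_insert {N : Type*} [DecidableEq N] (ℓ : N → N → Prop) (a : N) (A : Finset N) :
    reachSet ℓ (insert a A) = {x | Relation.ReflTransGen ℓ a x} ∪ reachSet ℓ A := by
  ext x
  simp [reachSet]

/-- The marginal gain of `a` counts the nodes reachable from `a` but not from `A`. -/
theorem spread_insert_sub_spread {N : Type*} [Finite N] [DecidableEq N] (ℓ : N → N → Prop)
    (a : N) (A : Finset N) :
    (spread ℓ (insert a A) : ℤ) - (spread ℓ A : ℤ) =
      (({x | Relation.ReflTransGen ℓ a x} \ reachSet ℓ A).ncard : ℤ) := by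
  rw [spread, spread, reachSet_insert, ← Set.sdiff_union_self,
    Set.ncard_union_eq Set.disjoint_sdiff_left (Set.toFinite _) (Set.toFinite _)]
  push_cast
  ring

/-- Layers are monotone along paths of a layered relation. -/
theorem layer_le_of_reflTransGen {V : Type*} {T : ℕ}
    {ℓ : V × Fin (T + 1) → V × Fin (T + 1) → Prop}
    (hlayer : ∀ (v w : V) (s s' : Fin (T + 1)),
      ℓ (v, s) (w, s') → (s' : ℕ) = (s : ℕ) + 1)
    {x y : V × Fin (T + 1)} (h : Relation.ReflTransGen ℓ x y) : x.2 ≤ y.2 := by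
  induction h with
  | refl => exact le_rfl
  | tail _ hbc ih =>
    have := hlayer _ _ _ _ hbc
    exact ih.trans (Fin.le_def.mpr (by omega))

/-- A node reachable from a seed set that is forward-closed below layer `t` is reachable from the
layer-`t` seeds, or is itself a seed below layer `t`. -/
theorem mem_reachSet_filter_or_mem {V : Type*} [DecidableEq V] {T : ℕ}
    {ℓ : V × Fin (T + 1) → V × Fin (T + 1) → Prop} {t : Fin (T + 1)}
    {D : Finset (V × Fin (T + 1))}
    (hbelow : ∀ (u : V) (s : Fin (T + 1)), (u, s) ∈ D → (s : ℕ) ≤ (t : ℕ))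
    (hclosed : ∀ (u : V) (s : Fin (T + 1)), (u, s) ∈ D → (s : ℕ) < (t : ℕ) →
      ∀ (w : V) (s' : Fin (T + 1)), ℓ (u, s) (w, s') → (w, s') ∈ D)
    {x : V × Fin (T + 1)} (hx : x ∈ reachSet ℓ D) :
    x ∈ reachSet ℓ (D.filter (fun x => x.2 = t)) ∨ x ∈ D ∧ x.2 < t := by
  have seed : ∀ z ∈ D, z ∈ reachSet ℓ (D.filter (fun x => x.2 = t)) ∨ z ∈ D ∧ z.2 < t := by
    intro z hz
    rcases (Fin.le_def.mpr (hbelow z.1 z.2 hz)).eq_or_lt with h | h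
    · exact Or.inl ⟨z, Finset.mem_filter.mpr ⟨hz, h⟩, .refl⟩
    · exact Or.inr ⟨hz, h⟩
  obtain ⟨y, hy, hyx⟩ := hx
  induction hyx with
  | refl => exact seed y hy
  | tail _ hbc ih =>
    rcases ih with ⟨z, hz, hzb⟩ | ⟨hb, hbt⟩
    · exact Or.inl ⟨z, hz, hzb.tail hbc⟩
    · exact seed _ (hclosed _ _ hb hbt _ _ hbc)

/-- Lemma 2, Markovian result on layers: for a layered relation
`ℓ` on `V × Fin (T+1)` and a finset `D` living in layers `≤ t` which is
forward-closed below layer `t`, the marginal gain of seeding `(v, t)` depends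
only on the layer-`t` part `D_t` of `D`:
`f(D ∪ {(v, t)}) − f(D) = f(D_t ∪ {(v, t)}) − f(D_t)` in `ℤ`. -/
theorem marginal_gain_markov {V : Type*} [Fintype V] [DecidableEq V] (T : ℕ)
    (ℓ : V × Fin (T + 1) → V × Fin (T + 1) → Prop)
    (hlayer : ∀ (v w : V) (s s' : Fin (T + 1)),
      ℓ (v, s) (w, s') → (s' : ℕ) = (s : ℕ) + 1)
    (t : Fin (T + 1)) (D : Finset (V × Fin (T + 1)))
    (hbelow : ∀ (u : V) (s : Fin (T + 1)), (u, s) ∈ D → (s : ℕ) ≤ (t : ℕ))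
    (hclosed : ∀ (u : V) (s : Fin (T + 1)), (u, s) ∈ D → (s : ℕ) < (t : ℕ) →
      ∀ (w : V) (s' : Fin (T + 1)), ℓ (u, s) (w, s') → (w, s') ∈ D)
    (v : V) :
    (spread ℓ (insert (v, t) D) : ℤ) - (spread ℓ D : ℤ) =
      (spread ℓ (insert (v, t) (D.filter (fun x => x.2 = t))) : ℤ) -
        (spread ℓ (D.filter (fun x => x.2 = t)) : ℤ) := by
  rw [spread_insert_sub_spread, spread_insert_sub_spread]
  congr 2
  ext x
  refine and_congr_right fun hx => not_congr
    ⟨fun h => ?_, fun h => reachSet_mono ℓ (Finset.filter_subset _ _) h⟩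
  exact (mem_reachSet_filter_or_mem hbelow hclosed h).resolve_right
    fun h' => (layer_le_of_reflTransGen hlayer hx).not_gt h'.2
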